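/- arXiv:2604.02675 — 3 statements merged into one kernel-verified Lean document; each statement's English description precedes it below -/
import Mathlib

section
/- Sufficiency of the penalty parameter for constraint enforcement in the QUBO: if λ > 2·(Σ_{s ∈ S} |c_s| + Σ_{s ≠ r} |β_{sr}|) and 0 ≤ k ≤ |S|, then every minimizer u* of H over all subsets of S satisfies the cardinality constraint |u*| = k. -/
/-- The linear and quadratic terms over a subset are bounded by the total absolute weight. -/
theorem abs_linear_add_pair_sum_le {α : Type*} [DecidableEq α] {S w : Finset α} (hw : w ⊆ S)
    (c : α → ℝ) (β : α → α → ℝ) :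
    |(∑ s ∈ w, c s) + ∑ s ∈ w, ∑ r ∈ w.erase s, β s r| ≤
      (∑ s ∈ S, |c s|) + ∑ s ∈ S, ∑ r ∈ S.erase s, |β s r| := by
  refine (abs_add_le _ _).trans (add_le_add ?_ ?_)
  · exact (Finset.abs_sum_le_sum_abs _ _).trans
      (Finset.sum_le_sum_of_subset_of_nonneg hw fun _ _ _ => abs_nonneg _)
  · calc |∑ s ∈ w, ∑ r ∈ w.erase s, β s r|
        ≤ ∑ s ∈ w, |∑ r ∈ w.erase s, β s r| := Finset.abs_sum_le_sum_abs _ _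
      _ ≤ ∑ s ∈ w, ∑ r ∈ S.erase s, |β s r| :=
          Finset.sum_le_sum fun s _ => (Finset.abs_sum_le_sum_abs _ _).trans
            (Finset.sum_le_sum_of_subset_of_nonneg (Finset.erase_subset_erase s hw)
              fun _ _ _ => abs_nonneg _)
      _ ≤ ∑ s ∈ S, ∑ r ∈ S.erase s, |β s r| :=
          Finset.sum_le_sum_of_subset_of_nonneg hw
            fun _ _ _ => Finset.sum_nonneg fun _ _ => abs_nonneg _

/-- Sufficiency of the penalty parameter: if
`λ > 2·(Σ_{s ∈ S} |c s| + Σ_{s ≠ r} |β s r|)` and `0 ≤ k ≤ |S|`, then every minimizer of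
the QUBO energy `H` over all subsets of `S` satisfies the cardinality constraint. -/
theorem penalty_enforces_cardinality
    {α : Type*} [DecidableEq α] (S : Finset α) (hS : S.Nonempty)
    (k : ℕ) (hk : k ≤ S.card)
    (c : α → ℝ) (β : α → α → ℝ) (lam : ℝ)
    (hlam : 2 * ((∑ s ∈ S, |c s|) + ∑ s ∈ S, ∑ r ∈ S.erase s, |β s r|) < lam)
    (H : Finset α → ℝ)
    (hH : ∀ u : Finset α,
      H u = -(∑ s ∈ u, c s) - (∑ s ∈ u, ∑ r ∈ u.erase s, β s r)
            + lam * ((u.card : ℝ) - (k : ℝ)) ^ 2)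
    (u : Finset α) (hu : u ⊆ S) (hmin : ∀ v : Finset α, v ⊆ S → H u ≤ H v) :
    u.card = k := by
  by_contra hne
  obtain ⟨v, hvS, hvk⟩ := Finset.exists_subset_card_eq hk
  have hle := hmin v hvS
  rw [hH u, hH v, hvk, sub_self] at hle
  have hu_bound := abs_le.mp (abs_linear_add_pair_sum_le hu c β)
  have hv_bound := abs_le.mp (abs_linear_add_pair_sum_le hvS c β)
  have hlam_nonneg : 0 ≤ lam := by linarith [hu_bound.1, hu_bound.2]
  have hsq : (1 : ℝ) ≤ ((u.card : ℝ) - (k : ℝ)) ^ 2 := by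
    have hz : (u.card : ℤ) - k ≠ 0 := by omega
    have hz_sq : (1 : ℤ) ≤ ((u.card : ℤ) - k) ^ 2 := by
      have := sq_pos_of_ne_zero hz
      omega
    exact_mod_cast hz_sq
  have hpen := le_mul_of_one_le_right hlam_nonneg hsq
  linarith [hu_bound.2, hv_bound.1]
end

section
/- Exact equivalence of the penalized QUBO and the cardinality-constrained problem: if λ > 2·(Σ_{s ∈ S} |c_s| + Σ_{s ≠ r} |β_{sr}|) and 0 ≤ k ≤ |S|, then a subset u ⊆ S minimizes H over all subsets of S if and only if |u| = k and u maximizes the objective Σ_{s ∈ u} c_s + Σ_{s, r ∈ u, s ≠ r} β_{sr} among all subsets of S of cardinality k. -/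
/-- The linear-plus-quadratic objective of a subset of `S` is bounded by the sum of the absolute
values of all its coefficients over `S`. -/
theorem abs_quadratic_objective_le {α : Type*} [DecidableEq α] {S v : Finset α} (hv : v ⊆ S)
    (c : α → ℝ) (β : α → α → ℝ) :
    |(∑ s ∈ v, c s) + ∑ s ∈ v, ∑ r ∈ v.erase s, β s r| ≤
      (∑ s ∈ S, |c s|) + ∑ s ∈ S, ∑ r ∈ S.erase s, |β s r| := by
  refine (abs_add_le _ _).trans (add_le_add ?_ ?_)
  · exact (Finset.abs_sum_le_sum_abs _ _).trans
      (Finset.sum_le_sum_of_subset_of_nonneg hv fun _ _ _ => abs_nonneg _)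
  · calc |∑ s ∈ v, ∑ r ∈ v.erase s, β s r|
        ≤ ∑ s ∈ v, |∑ r ∈ v.erase s, β s r| := Finset.abs_sum_le_sum_abs _ _
      _ ≤ ∑ s ∈ v, ∑ r ∈ S.erase s, |β s r| := Finset.sum_le_sum fun s _ =>
          (Finset.abs_sum_le_sum_abs _ _).trans
            (Finset.sum_le_sum_of_subset_of_nonneg (Finset.erase_subset_erase s hv)
              fun _ _ _ => abs_nonneg _)
      _ ≤ ∑ s ∈ S, ∑ r ∈ S.erase s, |β s r| :=
          Finset.sum_le_sum_of_subset_of_nonneg hv fun _ _ _ =>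
            Finset.sum_nonneg fun _ _ => abs_nonneg _

/-- Exact penalization of a cardinality constraint: if the penalty weight exceeds twice a bound
on `|f|`, the minimizers of `-f v + lam * (#v - k) ^ 2` over the subsets of `S` are the maximizers
of `f` over the subsets of cardinality `k`. -/
theorem minimizes_card_penalty_iff {α : Type*} {S : Finset α} {k : ℕ} (hk : k ≤ S.card)
    {f : Finset α → ℝ} {B lam : ℝ} (hf : ∀ v ⊆ S, |f v| ≤ B) (hlam : 2 * B < lam)
    {u : Finset α} (hu : u ⊆ S) :
    (∀ v ⊆ S, -f u + lam * ((u.card : ℝ) - k) ^ 2 ≤ -f v + lam * ((v.card : ℝ) - k) ^ 2) ↔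
      u.card = k ∧ ∀ v ⊆ S, v.card = k → f v ≤ f u := by
  have hB : 0 ≤ B := (abs_nonneg _).trans (hf u hu)
  have penalty_ge (v : Finset α) (hv : v.card ≠ k) : lam ≤ lam * ((v.card : ℝ) - k) ^ 2 := by
    have h : (1 : ℤ) ≤ ((v.card : ℤ) - k) ^ 2 :=
      Int.add_one_le_of_lt (sq_pos_of_ne_zero (sub_ne_zero.mpr (by exact_mod_cast hv)))
    exact le_mul_of_one_le_right (by linarith) (by exact_mod_cast h)
  constructor
  · intro h
    have hcard : u.card = k := by
      by_contra hne
      obtain ⟨w, hwS, hwk⟩ := Finset.exists_subset_card_eq hk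
      have hw := h w hwS
      rw [hwk, sub_self] at hw
      linarith [penalty_ge u hne, (abs_le.mp (hf u hu)).2, (abs_le.mp (hf w hwS)).1]
    refine ⟨hcard, fun v hv hvk => ?_⟩
    have hle := h v hv
    rw [hcard, hvk] at hle
    linarith
  · rintro ⟨hcard, hmax⟩ v hv
    rw [hcard, sub_self]
    by_cases hvk : v.card = k
    · rw [hvk, sub_self]
      linarith [hmax v hv hvk]
    · linarith [penalty_ge v hvk, (abs_le.mp (hf v hv)).2, (abs_le.mp (hf u hu)).1]

/-- Exact equivalence of the penalized QUBO and the cardinality-constrained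
problem: under a sufficiently large penalty, `u ⊆ S` minimizes `H` over all subsets of `S`
iff `|u| = k` and `u` maximizes `Σ_{s∈u} c s + Σ_{s≠r∈u} β s r` among size-`k` subsets. -/
theorem qubo_equiv_constrained
    {α : Type*} [DecidableEq α] (S : Finset α) (hS : S.Nonempty)
    (k : ℕ) (hk : k ≤ S.card)
    (c : α → ℝ) (β : α → α → ℝ) (lam : ℝ)
    (hlam : 2 * ((∑ s ∈ S, |c s|) + ∑ s ∈ S, ∑ r ∈ S.erase s, |β s r|) < lam)
    (H : Finset α → ℝ)
    (hH : ∀ u : Finset α,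
      H u = -(∑ s ∈ u, c s) - (∑ s ∈ u, ∑ r ∈ u.erase s, β s r)
            + lam * ((u.card : ℝ) - (k : ℝ)) ^ 2)
    (u : Finset α) (hu : u ⊆ S) :
    (∀ v : Finset α, v ⊆ S → H u ≤ H v) ↔
      (u.card = k ∧
        ∀ v : Finset α, v ⊆ S → v.card = k →
          (∑ s ∈ v, c s) + (∑ s ∈ v, ∑ r ∈ v.erase s, β s r) ≤
            (∑ s ∈ u, c s) + (∑ s ∈ u, ∑ r ∈ u.erase s, β s r)) := by
  have key := minimizes_card_penalty_iff hk
    (f := fun v => (∑ s ∈ v, c s) + ∑ s ∈ v, ∑ r ∈ v.erase s, β s r)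
    (fun v hv => abs_quadratic_objective_le hv c β) hlam hu
  simpa only [hH, neg_add'] using key
end

section
/- Equivalence of the QUBO and the critical link identification problem for the time-dependent delay model: take c_s = (γ − 1)·t_s and β_{sr} = 0 in the QUBO energy H(u) = −Σ_{s ∈ u} c_s + λ·(|u| − k)². If λ > 2·(γ − 1)·Σ_{s ∈ S} t_s and 0 ≤ k ≤ |S|, then a subset u ⊆ S minimizes H over all subsets of S if and only if |u| = k and u maximizes the network delay index NDI among all size-k disruption scenarios. -/
/-- Equivalence of the QUBO and the critical link identification problem
for the time-dependent delay model: with `c s = (γ−1)·t s`, `β = 0`, and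
`λ > 2·(γ−1)·Σ_{s∈S} t s`, a subset `u ⊆ S` minimizes
`H(u) = −Σ_{s∈u} c s + λ·(|u|−k)²` over all subsets of `S` iff `|u| = k` and `u`
maximizes `NDI` among all size-`k` disruption scenarios. -/
theorem qubo_equiv_critical_link_identification
    {α : Type*} [DecidableEq α] (S : Finset α) (hS : S.Nonempty)
    (t t0 : α → ℝ) (ht : ∀ s ∈ S, 0 ≤ t s) (ht0 : ∀ s ∈ S, t0 s ≤ t s)
    (γ : ℝ) (hγ : 1 < γ)
    (NDI : Finset α → ℝ)
    (hNDI : ∀ u : Finset α, NDI u = ∑ s ∈ S, ((if s ∈ u then γ * t s else t s) - t0 s))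
    (k : ℕ) (hk : k ≤ S.card)
    (lam : ℝ) (hlam0 : 0 < lam)
    (hlam : 2 * (γ - 1) * ∑ s ∈ S, t s < lam)
    (H : Finset α → ℝ)
    (hH : ∀ u : Finset α,
      H u = -(∑ s ∈ u, (γ - 1) * t s) + lam * ((u.card : ℝ) - (k : ℝ)) ^ 2)
    (u : Finset α) (hu : u ⊆ S) :
    (∀ v : Finset α, v ⊆ S → H u ≤ H v) ↔
      (u.card = k ∧ ∀ v : Finset α, v ⊆ S → v.card = k → NDI v ≤ NDI u) := by
  have c_nonneg : ∀ s ∈ S, 0 ≤ (γ - 1) * t s := fun s hs =>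
    mul_nonneg (by linarith) (ht s hs)
  have NDI_eq : ∀ v, v ⊆ S →
      NDI v = ∑ s ∈ v, (γ - 1) * t s + ∑ s ∈ S, (t s - t0 s) := by
    intro v hv
    rw [hNDI, ← Finset.inter_eq_right.mpr hv, ← Finset.sum_ite_mem, ← Finset.sum_add_distrib,
      Finset.inter_eq_right.mpr hv]
    refine Finset.sum_congr rfl fun s _ => ?_
    split_ifs <;> ring
  have H_eq : ∀ v : Finset α, v.card = k → H v = -∑ s ∈ v, (γ - 1) * t s := by
    intro v hv
    simp [hH, hv]
  have H_lt : ∀ w v, w ⊆ S → v ⊆ S → w.card = k → v.card ≠ k → H w < H v := by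
    intro w v hw hv hwk hvk
    have hw0 : 0 ≤ ∑ s ∈ w, (γ - 1) * t s := Finset.sum_nonneg fun s hs => c_nonneg s (hw hs)
    have hS0 : 0 ≤ ∑ s ∈ S, (γ - 1) * t s := Finset.sum_nonneg c_nonneg
    have hvS : ∑ s ∈ v, (γ - 1) * t s ≤ ∑ s ∈ S, (γ - 1) * t s :=
      Finset.sum_le_sum_of_subset_of_nonneg hv fun s hs _ => c_nonneg s hs
    have hS_lt : 2 * ∑ s ∈ S, (γ - 1) * t s < lam := by
      rwa [← Finset.mul_sum, ← mul_assoc]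
    have one_le : (1 : ℝ) ≤ ((v.card : ℝ) - (k : ℝ)) ^ 2 := by
      have h : (1 : ℤ) ≤ ((v.card : ℤ) - (k : ℤ)) ^ 2 :=
        Int.add_one_le_of_lt (sq_pos_of_ne_zero (by omega))
      exact_mod_cast h
    have lam_le := le_mul_of_one_le_right hlam0.le one_le
    rw [H_eq w hwk, hH v]
    linarith
  constructor
  · intro hmin
    have huk : u.card = k := by
      by_contra hne
      obtain ⟨w, hw, hwk⟩ := Finset.exists_subset_card_eq hk
      exact (H_lt w u hw hu hwk hne).not_ge (hmin w hw)
    refine ⟨huk, fun v hv hvk => ?_⟩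
    have h := hmin v hv
    rw [H_eq u huk, H_eq v hvk] at h
    rw [NDI_eq u hu, NDI_eq v hv]
    linarith
  · rintro ⟨huk, hmax⟩ v hv
    by_cases hvk : v.card = k
    · have h := hmax v hv hvk
      rw [NDI_eq u hu, NDI_eq v hv] at h
      rw [H_eq u huk, H_eq v hvk]
      linarith
    · exact (H_lt u v hu hv huk hvk).le
end
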